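/- Let x be a complex number and α a complex number such that none of 2α, 2α+1, α+1/2, and α+3/2 is a nonpositive integer. Then ₁F₁(α; 2α; x) · ₁F₁(α; 2α+1; x) = e^x · [ ₁F₂(α; α+1/2, 2α; x²/4) − (x/(2(2α+1))) · ₁F₂(α+1; α+3/2, 2α+1; x²/4) ]. -/

import Mathlib

/-- Pochhammer symbol (rising factorial) `(c)_k = c (c+1) ⋯ (c+k-1)` for complex `c`. -/
noncomputable def poch (c : ℂ) (k : ℕ) : ℂ := ∏ l ∈ Finset.range k, (c + l)

/-- Generalized hypergeometric series `ₚF_q(a; b; x) = Σ_k (a₁)_k⋯(a_p)_k / ((b₁)_k⋯(b_q)_k) · x^k/k!`. -/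
noncomputable def pFq (a b : List ℂ) (x : ℂ) : ℂ :=
  ∑' k : ℕ, ((a.map (fun c => poch c k)).prod / (b.map (fun c => poch c k)).prod)
    * x ^ k / (Nat.factorial k)

/-- `c` is not a nonpositive integer, i.e. `c ≠ 0, -1, -2, …`. -/
def NotNonposInt (c : ℂ) : Prop := ∀ n : ℕ, c ≠ -(n : ℂ)

open Filter Topology in
/-- If the ratios of consecutive terms tend to zero, the series converges absolutely. -/
theorem summable_norm_of_ratio_tendsto_zero {f ρ : ℕ → ℂ} (hρ : Tendsto ρ atTop (𝓝 0))
    (hf : ∀ n, f (n + 1) = f n * ρ n) : Summable fun n => ‖f n‖ := by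
  refine summable_of_ratio_norm_eventually_le (r := 1 / 2) (by norm_num) ?_
  have h : ∀ᶠ n in atTop, ‖ρ n‖ < 1 / 2 := by
    have := hρ.norm
    rw [norm_zero] at this
    exact this.eventually_lt_const (by norm_num)
  filter_upwards [h] with n hn
  rw [hf, norm_norm, norm_norm, norm_mul, mul_comm]
  gcongr

open Filter Topology in
theorem tendsto_inv_add_natCast (c : ℂ) :
    Tendsto (fun n : ℕ => (c + n)⁻¹) atTop (𝓝 0) :=
  tendsto_inv₀_cobounded.comp
    ((tendsto_const_add_cobounded c).comp tendsto_natCast_atTop_cobounded)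

open Filter Topology in
theorem tendsto_add_natCast_div (a b : ℂ) :
    Tendsto (fun n : ℕ => (a + n) / (b + n)) atTop (𝓝 1) := by
  have h := ((tendsto_inv_add_natCast b).const_mul (a - b)).const_add 1
  rw [mul_zero, add_zero] at h
  refine h.congr' ?_
  have hb : ∀ᶠ n : ℕ in atTop, b + n ≠ 0 :=
    ((tendsto_const_add_cobounded b).comp
      tendsto_natCast_atTop_cobounded).eventually_ne_cobounded 0
  filter_upwards [hb] with n hn
  field_simp
  ring

theorem poch_succ (c : ℂ) (k : ℕ) : poch c (k + 1) = poch c k * (c + k) :=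
  Finset.prod_range_succ _ _

theorem poch_succ' (c : ℂ) (k : ℕ) : poch c (k + 1) = c * poch (c + 1) k := by
  rw [poch, poch, Finset.prod_range_succ', mul_comm]
  simp only [Nat.cast_zero, add_zero, Nat.cast_add, Nat.cast_one, add_assoc, add_comm (1 : ℂ)]

theorem NotNonposInt.add_natCast_ne_zero {c : ℂ} (hc : NotNonposInt c) (n : ℕ) :
    c + n ≠ 0 :=
  fun h => hc n (eq_neg_of_add_eq_zero_left h)

theorem NotNonposInt.poch_ne_zero {c : ℂ} (hc : NotNonposInt c) (k : ℕ) : poch c k ≠ 0 :=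
  Finset.prod_ne_zero_iff.2 fun n _ => hc.add_natCast_ne_zero n

/-- The general coefficient of `₁F₁(a; b; x)`. -/
noncomputable def kummerCoeff (a b : ℂ) (n : ℕ) : ℂ := poch a n / poch b n / n.factorial

/-- The general coefficient of `₁F₂(a; b, c; x)`. -/
noncomputable def oneFTwoCoeff (a b c : ℂ) (n : ℕ) : ℂ :=
  poch a n / (poch b n * poch c n) / n.factorial

theorem kummerCoeff_succ (a b : ℂ) (n : ℕ) :
    kummerCoeff a b (n + 1) = kummerCoeff a b n * ((a + n) / (b + n) * (1 + (n : ℂ))⁻¹) := by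
  simp only [kummerCoeff, poch_succ, Nat.factorial_succ, div_eq_mul_inv, mul_inv, Nat.cast_mul,
    Nat.cast_add, Nat.cast_one, add_comm (n : ℂ) 1]
  ring

theorem oneFTwoCoeff_succ (a b c : ℂ) (n : ℕ) :
    oneFTwoCoeff a b c (n + 1) =
      oneFTwoCoeff a b c n * ((a + n) / (b + n) * (c + n)⁻¹ * (1 + (n : ℂ))⁻¹) := by
  simp only [oneFTwoCoeff, poch_succ, Nat.factorial_succ, div_eq_mul_inv, mul_inv, Nat.cast_mul,
    Nat.cast_add, Nat.cast_one, add_comm (n : ℂ) 1]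
  ring

theorem pFq_one_one (a b x : ℂ) : pFq [a] [b] x = ∑' n, kummerCoeff a b n * x ^ n :=
  tsum_congr fun n => by simp [kummerCoeff]; ring

theorem pFq_one_two (a b c x : ℂ) :
    pFq [a] [b, c] x = ∑' n, oneFTwoCoeff a b c n * x ^ n :=
  tsum_congr fun n => by simp [oneFTwoCoeff]; ring

theorem summable_kummerCoeff (a b x : ℂ) :
    Summable fun n => ‖kummerCoeff a b n * x ^ n‖ := by
  refine summable_norm_of_ratio_tendsto_zero
    (ρ := fun n : ℕ => (a + n) / (b + n) * (1 + (n : ℂ))⁻¹ * x) ?_ fun n => ?_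
  · simpa using ((tendsto_add_natCast_div a b).mul (tendsto_inv_add_natCast 1)).mul_const x
  · rw [kummerCoeff_succ]; ring

theorem summable_oneFTwoCoeff (a b c x : ℂ) :
    Summable fun n => ‖oneFTwoCoeff a b c n * x ^ n‖ := by
  refine summable_norm_of_ratio_tendsto_zero
    (ρ := fun n : ℕ => (a + n) / (b + n) * (c + n)⁻¹ * (1 + (n : ℂ))⁻¹ * x) ?_ fun n => ?_
  · simpa using (((tendsto_add_natCast_div a b).mul (tendsto_inv_add_natCast c)).mul
      (tendsto_inv_add_natCast 1)).mul_const x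
  · rw [oneFTwoCoeff_succ]; ring

/-- Cauchy product for values of power series that converge absolutely at `x`. -/
theorem PowerSeries.tsum_coeff_mul {f g : PowerSeries ℂ} {x : ℂ}
    (hf : Summable fun n => ‖coeff n f * x ^ n‖) (hg : Summable fun n => ‖coeff n g * x ^ n‖) :
    (Summable fun n => ‖coeff n (f * g) * x ^ n‖) ∧
      ∑' n, coeff n (f * g) * x ^ n =
        (∑' n, coeff n f * x ^ n) * ∑' n, coeff n g * x ^ n := by
  have key : ∀ n, ∑ kl ∈ Finset.HasAntidiagonal.antidiagonal n,
      (coeff kl.1 f * x ^ kl.1) * (coeff kl.2 g * x ^ kl.2) = coeff n (f * g) * x ^ n := by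
    intro n
    rw [coeff_mul, Finset.sum_mul]
    refine Finset.sum_congr rfl fun kl hkl => ?_
    rw [← Finset.HasAntidiagonal.mem_antidiagonal.1 hkl, pow_add]
    ring
  constructor
  · simpa only [key] using summable_norm_sum_mul_antidiagonal_of_summable_norm hf hg
  · rw [tsum_mul_tsum_eq_tsum_sum_antidiagonal_of_summable_norm hf hg]
    exact tsum_congr fun n => (key n).symm

open PowerSeries

/-- The power series of `exp (c x)`. -/
noncomputable def expSeries (c : ℂ) : ℂ⟦X⟧ := PowerSeries.mk fun n => c ^ n / n.factorial

theorem derivative_expSeries (c : ℂ) : d⁄dX ℂ (expSeries c) = C c * expSeries c := by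
  ext n
  have : ((n : ℂ) + 1) ≠ 0 := n.cast_add_one_ne_zero
  have h2 : (n.factorial : ℂ) ≠ 0 := mod_cast n.factorial_ne_zero
  simp only [expSeries, coeff_derivative, coeff_mk, coeff_C_mul, Nat.factorial_succ]
  push_cast
  field_simp
  ring

theorem hasSum_expSeries (c x : ℂ) :
    (Summable fun n => ‖coeff n (expSeries c) * x ^ n‖) ∧
      ∑' n, coeff n (expSeries c) * x ^ n = Complex.exp (c * x) := by
  have h : ∀ n, coeff n (expSeries c) * x ^ n = (c * x) ^ n / n.factorial := fun n => by
    simp only [expSeries, coeff_mk, mul_pow]; ring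
  simp only [h]
  exact ⟨NormedSpace.norm_expSeries_div_summable (c * x), by
    rw [Complex.exp_eq_exp_ℂ, NormedSpace.exp_eq_tsum_div]⟩

/-- The power series of `₁F₁(a; b; x)`. -/
noncomputable def kummerSeries (a b : ℂ) : ℂ⟦X⟧ := PowerSeries.mk (kummerCoeff a b)

/-- Kummer's differential equation. -/
theorem kummerSeries_ode {a b : ℂ} (hb : NotNonposInt b) :
    X * d⁄dX ℂ (d⁄dX ℂ (kummerSeries a b)) + (C b - X) * d⁄dX ℂ (kummerSeries a b)
      - C a * kummerSeries a b = 0 := by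
  ext n
  have h0 := hb.add_natCast_ne_zero n
  have h1 : (1 + (n : ℂ)) ≠ 0 := by rw [add_comm]; exact n.cast_add_one_ne_zero
  have hrec : (b + n) * (1 + n) * kummerCoeff a b (n + 1) = (a + n) * kummerCoeff a b n := by
    rw [kummerCoeff_succ]; field_simp
  rcases n with _ | n <;>
    simp only [map_sub, map_add, sub_mul, coeff_C_mul, coeff_succ_X_mul, coeff_zero_X_mul,
      coeff_derivative, kummerSeries, coeff_mk, map_zero] at hrec ⊢ <;>
    push_cast at hrec ⊢ <;>
    linear_combination hrec

/-- A contiguity relation for Kummer's function. -/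
theorem kummerSeries_contiguous {a : ℂ} (ha : NotNonposInt (2 * a)) :
    kummerSeries a (2 * a + 1) =
      C 2 * kummerSeries a (2 * a) - C 2 * d⁄dX ℂ (kummerSeries a (2 * a)) := by
  ext n
  have h0 := ha.add_natCast_ne_zero n
  have h1 : (1 + (n : ℂ)) ≠ 0 := by rw [add_comm]; exact n.cast_add_one_ne_zero
  have ha0 : a ≠ 0 := fun h => ha 0 (by simp [h])
  have hp : poch (2 * a) n * (2 * a + n) = 2 * a * poch (2 * a + 1) n := by
    rw [← poch_succ, poch_succ']
  have h3 : kummerCoeff a (2 * a + 1) n = kummerCoeff a (2 * a) n * (2 * a / (2 * a + n)) := by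
    have hP : poch (2 * a + 1) n = poch (2 * a) n * (2 * a + n) / (2 * a) := by
      rw [hp]; field_simp
    have := ha.poch_ne_zero n
    have h2 : (n.factorial : ℂ) ≠ 0 := mod_cast n.factorial_ne_zero
    rw [kummerCoeff, kummerCoeff, hP]
    field_simp
  simp only [kummerSeries, map_sub, coeff_C_mul, coeff_derivative, coeff_mk, kummerCoeff_succ, h3]
  field_simp
  ring

/-- The power series of `exp (-x/2) ₁F₁(a; 2a; x)`. -/
noncomputable def kummerBessel (a : ℂ) : ℂ⟦X⟧ :=
  expSeries (-(1 / 2)) * kummerSeries a (2 * a)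

theorem kummerBessel_ode {a : ℂ} (ha : NotNonposInt (2 * a)) :
    X * d⁄dX ℂ (d⁄dX ℂ (kummerBessel a)) + C (2 * a) * d⁄dX ℂ (kummerBessel a)
      - C (1 / 4) * (X * kummerBessel a) = 0 := by
  have h := kummerSeries_ode (a := a) ha
  have hD : ∀ c : ℂ, d⁄dX ℂ (C c) = 0 := fun c => derivative_C
  have h2 : (C (-(1 / 2)) : ℂ⟦X⟧) * C 2 = -1 := by rw [← map_mul]; norm_num
  have h4 : (C (1 / 4) : ℂ⟦X⟧) = C (-(1 / 2)) ^ 2 := by rw [← map_pow]; norm_num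
  have h5 : (C (2 * a) : ℂ⟦X⟧) = C 2 * C a := map_mul _ _ _
  have h6 : (C 2 : ℂ⟦X⟧) = 2 := map_ofNat _ 2
  rw [h5] at h ⊢
  rw [h4]
  rw [h6] at h h2 ⊢
  simp only [kummerBessel, Derivation.leibniz, map_add, derivative_expSeries, hD, smul_eq_mul,
    mul_zero, add_zero]
  set F := kummerSeries a (2 * a)
  set E := expSeries (-(1 / 2))
  linear_combination E * h + (X * d⁄dX ℂ F * E + E * C a * F) * h2

theorem coeff_kummerBessel_odd {a : ℂ} (ha : NotNonposInt (2 * a)) (m : ℕ) :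
    coeff (2 * m + 1) (kummerBessel a) = 0 := by
  have hode := kummerBessel_ode ha
  induction m with
  | zero =>
    have h := congrArg (coeff 0) hode
    have := ha.add_natCast_ne_zero 0
    simp only [map_sub, map_add, coeff_C_mul, coeff_zero_X_mul, coeff_derivative, map_zero] at h
    rw [Nat.cast_zero, add_zero] at this
    simpa [-coeff_zero_eq_constantCoeff, this] using h
  | succ m ih =>
    have h := congrArg (coeff (2 * m + 1 + 1)) hode
    simp only [map_sub, map_add, coeff_C_mul, coeff_succ_X_mul, coeff_derivative, map_zero, ih,
      mul_zero, sub_zero] at h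
    have h1 := ha.add_natCast_ne_zero (2 * m + 2)
    have h2 : ((2 * m + 2 : ℕ) : ℂ) + 1 ≠ 0 := Nat.cast_add_one_ne_zero _
    push_cast at h h1 h2
    have h3 : (2 * a + (2 * m + 2)) * (2 * m + 2 + 1) *
        coeff (2 * m + 1 + 1 + 1) (kummerBessel a) = 0 := by
      linear_combination h
    exact (mul_eq_zero.1 h3).resolve_left (mul_ne_zero h1 h2)

theorem coeff_kummerBessel_sq_odd {a : ℂ} (ha : NotNonposInt (2 * a)) (m : ℕ) :
    coeff (2 * m + 1) (kummerBessel a ^ 2) = 0 := by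
  rw [sq, coeff_mul]
  refine Finset.sum_eq_zero fun kl hkl => ?_
  have hkl := Finset.HasAntidiagonal.mem_antidiagonal.1 hkl
  rcases Nat.even_or_odd' kl.1 with ⟨k, hk | hk⟩
  · obtain ⟨l, hl⟩ : ∃ l, kl.2 = 2 * l + 1 := ⟨m - k, by omega⟩
    rw [hl, coeff_kummerBessel_odd ha, mul_zero]
  · rw [hk, coeff_kummerBessel_odd ha, zero_mul]

/-- The symmetric square of `kummerBessel_ode`. -/
theorem kummerBessel_sq_ode {a : ℂ} (ha : NotNonposInt (2 * a)) :
    X * (X * d⁄dX ℂ (d⁄dX ℂ (d⁄dX ℂ (kummerBessel a ^ 2))))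
      + C (6 * a) * (X * d⁄dX ℂ (d⁄dX ℂ (kummerBessel a ^ 2)))
      + C (2 * a * (4 * a - 1)) * d⁄dX ℂ (kummerBessel a ^ 2)
      - X * (X * d⁄dX ℂ (kummerBessel a ^ 2)) - C (2 * a) * (X * kummerBessel a ^ 2) = 0 := by
  have h := kummerBessel_ode ha
  have hD : ∀ c : ℂ, d⁄dX ℂ (C c) = 0 := fun c => derivative_C
  have h4 : (C (1 / 4) : ℂ⟦X⟧) * 4 = 1 := by
    rw [← map_ofNat (C (R := ℂ)) 4, ← map_mul]; norm_num
  have h' := congrArg (d⁄dX ℂ) h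
  simp only [Derivation.leibniz, map_add, map_sub, map_zero, map_mul, map_one, map_ofNat, hD,
    smul_eq_mul, mul_zero, derivative_X, mul_one, add_zero, sq] at h h' ⊢
  have hD2 : d⁄dX ℂ (2 : ℂ⟦X⟧) = 0 := by
    rw [← map_ofNat (C (R := ℂ)) 2]; exact hD 2
  simp only [hD2, mul_zero, add_zero] at h'
  set H := kummerBessel a
  linear_combination (2 * H * X) * h' + (6 * X * d⁄dX ℂ H + (8 * C a - 2) * H) * h
    + (2 * X * X * H * d⁄dX ℂ H + 2 * C a * X * H * H) * h4

/-- Preece's identity, at the level of coefficients. -/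
theorem coeff_kummerBessel_sq_even {a : ℂ} (ha : NotNonposInt (2 * a))
    (ha' : NotNonposInt (a + 1 / 2)) (m : ℕ) :
    coeff (2 * m) (kummerBessel a ^ 2) = oneFTwoCoeff a (a + 1 / 2) (2 * a) m / 4 ^ m := by
  induction m with
  | zero =>
    simp [kummerBessel, expSeries, kummerSeries, kummerCoeff, oneFTwoCoeff, poch]
  | succ m ih =>
    have h := congrArg (coeff (2 * m + 1)) (kummerBessel_sq_ode ha)
    have h1 := ha.add_natCast_ne_zero m
    have h2 := ha'.add_natCast_ne_zero m
    have h3 : (1 + (m : ℂ)) ≠ 0 := by rw [add_comm]; exact m.cast_add_one_ne_zero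
    have hrec : 4 * (1 + m) * (2 * a + m) * (a + 1 / 2 + m) *
        coeff (2 * (m + 1)) (kummerBessel a ^ 2) =
        (a + m) * coeff (2 * m) (kummerBessel a ^ 2) := by
      rcases m with _ | m
      · simp only [map_sub, map_add, coeff_C_mul, coeff_succ_X_mul, coeff_zero_X_mul,
          coeff_derivative, map_zero, mul_zero, zero_add] at h
        push_cast at h ⊢
        simp only [zero_add, mul_one] at h ⊢
        linear_combination h / 2
      · rw [show 2 * (m + 1) + 1 = 2 * m + 1 + 1 + 1 by ring] at h
        simp only [map_sub, map_add, coeff_C_mul, coeff_succ_X_mul, coeff_derivative,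
          map_zero] at h
        rw [show 2 * (m + 1 + 1) = 2 * m + 1 + 1 + 1 + 1 by ring,
          show 2 * (m + 1) = 2 * m + 1 + 1 by ring]
        push_cast at h ⊢
        linear_combination h / 2
    rw [oneFTwoCoeff_succ]
    rw [ih] at hrec
    refine mul_left_cancel₀ (mul_ne_zero (mul_ne_zero (mul_ne_zero (by norm_num : (4 : ℂ) ≠ 0) h3) h1) h2)
      (hrec.trans ?_)
    generalize oneFTwoCoeff a (a + 1 / 2) (2 * a) m = t
    generalize a + 1 / 2 + (m : ℂ) = u at *
    generalize 2 * a + (m : ℂ) = v at *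
    rw [pow_succ]
    field_simp

theorem oneFTwoCoeff_succ' {a b c : ℂ} (n : ℕ) :
    (n + 1) * oneFTwoCoeff a b c (n + 1) =
      a / (b * c) * oneFTwoCoeff (a + 1) (b + 1) (c + 1) n := by
  have h : ((n : ℂ) + 1) ≠ 0 := n.cast_add_one_ne_zero
  simp only [oneFTwoCoeff, poch_succ', Nat.factorial_succ, div_eq_mul_inv, mul_inv, Nat.cast_mul,
    Nat.cast_add, Nat.cast_one]
  field_simp

theorem kummerSeries_mul_contiguous {a : ℂ} (ha : NotNonposInt (2 * a)) :
    expSeries (-(1 / 2)) * expSeries (-(1 / 2)) *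
        (kummerSeries a (2 * a) * kummerSeries a (2 * a + 1)) =
      kummerBessel a ^ 2 - d⁄dX ℂ (kummerBessel a ^ 2) := by
  have h2 : (C (-(1 / 2)) : ℂ⟦X⟧) * 2 = -1 := by
    rw [← map_ofNat (C (R := ℂ)) 2, ← map_mul]; norm_num
  simp only [kummerSeries_contiguous ha, kummerBessel, Derivation.leibniz, derivative_expSeries,
    smul_eq_mul, sq, map_ofNat]
  set F := kummerSeries a (2 * a)
  set E := expSeries (-(1 / 2))
  linear_combination (E * E * F * F) * h2

theorem rathie_identity_1_12 (x α : ℂ)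
    (h1 : NotNonposInt (2*α)) (h2 : NotNonposInt (2*α + 1))
    (h3 : NotNonposInt (α + 1/2)) (h4 : NotNonposInt (α + 3/2)) :
    pFq [α] [2*α] x * pFq [α] [2*α + 1] x =
      Complex.exp x * (pFq [α] [α + 1/2, 2*α] (x^2/4)
        - x / (2 * (2*α + 1)) * pFq [α + 1] [α + 3/2, 2*α + 1] (x^2/4)) := by
  obtain ⟨hE, hE'⟩ := hasSum_expSeries (-(1 / 2)) x
  have hK : ∀ b, Summable fun n => ‖coeff n (kummerSeries α b) * x ^ n‖ := fun b => by
    simpa only [kummerSeries, coeff_mk] using summable_kummerCoeff α b x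
  obtain ⟨hEE, hEE'⟩ := tsum_coeff_mul hE hE
  obtain ⟨hKK, hKK'⟩ := tsum_coeff_mul (hK (2 * α)) (hK (2 * α + 1))
  have hmul := (tsum_coeff_mul hEE hKK).2
  rw [hEE', hKK', hE', kummerSeries_mul_contiguous h1, ← Complex.exp_add] at hmul
  simp only [kummerSeries, coeff_mk, ← pFq_one_one] at hmul
  have heven : ∀ m : ℕ, coeff (2 * m) (kummerBessel α ^ 2 - d⁄dX ℂ (kummerBessel α ^ 2)) *
      x ^ (2 * m) = oneFTwoCoeff α (α + 1 / 2) (2 * α) m * (x ^ 2 / 4) ^ m := fun m => by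
    rw [map_sub, coeff_derivative, coeff_kummerBessel_sq_odd h1,
      coeff_kummerBessel_sq_even h1 h3, div_pow, pow_mul]
    ring
  have hodd : ∀ m : ℕ, coeff (2 * m + 1) (kummerBessel α ^ 2 - d⁄dX ℂ (kummerBessel α ^ 2)) *
      x ^ (2 * m + 1) = -(x / (2 * (2 * α + 1))) *
        (oneFTwoCoeff (α + 1) (α + 3 / 2) (2 * α + 1) m * (x ^ 2 / 4) ^ m) := fun m => by
    have hα : α ≠ 0 := fun h => h1 0 (by simp [h])
    have hα1 : 2 * α + 1 ≠ 0 := fun h => h2 0 (by simp [h])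
    have hs := oneFTwoCoeff_succ' (a := α) (b := α + 1 / 2) (c := 2 * α) m
    rw [show α + 1 / 2 + 1 = α + 3 / 2 by ring,
      show α / ((α + 1 / 2) * (2 * α)) = 1 / (2 * α + 1) by
        rw [show α + 1 / 2 = (2 * α + 1) / 2 by ring]; field_simp] at hs
    rw [map_sub, coeff_derivative, coeff_kummerBessel_sq_odd h1,
      show 2 * m + 1 + 1 = 2 * (m + 1) by ring, coeff_kummerBessel_sq_even h1 h3, div_pow,
      pow_succ x, pow_mul, pow_succ (4 : ℂ)]
    push_cast
    rw [show x / (2 * (2 * α + 1)) = x / 2 * (1 / (2 * α + 1)) by field_simp]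
    linear_combination (-(x ^ 2) ^ m * x / (2 * 4 ^ m)) * hs
  have hsum := tsum_even_add_odd
    (f := fun n => coeff n (kummerBessel α ^ 2 - d⁄dX ℂ (kummerBessel α ^ 2)) * x ^ n)
    (by simpa only [heven] using (summable_oneFTwoCoeff _ _ _ _).of_norm)
    (by simpa only [hodd] using (summable_oneFTwoCoeff _ _ _ _).of_norm.mul_left _)
  simp only [heven, hodd, tsum_mul_left, ← pFq_one_two] at hsum
  rw [← hsum] at hmul
  have hexp : Complex.exp x * Complex.exp (-(1 / 2) * x + -(1 / 2) * x) = 1 := by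
    rw [← Complex.exp_add]; ring_nf; exact Complex.exp_zero
  linear_combination (-(pFq [α] [2*α] x * pFq [α] [2*α + 1] x)) * hexp - Complex.exp x * hmul
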